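/- Suppose P and B are projections and V is an isometry (V*V = 1) with P = V*(B ⊗ 1)V. Then (B ⊗ 1)V = VP. -/

import Mathlib

open Matrix
open scoped Kronecker

open scoped ComplexOrder in
/-- If the compression `P = Vᴴ Q V` of a projection `Q` along an isometry `V` is idempotent,
then `V` intertwines `P` and `Q`. -/
theorem Matrix.mul_isometry_eq_isometry_mul_of_compression {m n : Type*}
    [Fintype m] [Fintype n] [DecidableEq n]
    {V : Matrix m n ℂ} (hV : Vᴴ * V = 1)
    {P : Matrix n n ℂ} (hP : P * P = P)
    {Q : Matrix m m ℂ} (hQherm : Qᴴ = Q) (hQproj : Q * Q = Q)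
    (h : P = Vᴴ * Q * V) :
    Q * V = V * P := by
  have hPherm : Pᴴ = P := by
    rw [h]
    simp only [conjTranspose_mul, conjTranspose_conjTranspose, hQherm, Matrix.mul_assoc]
  have h₁ : Vᴴ * Q * (Q * V) = P := by
    rw [Matrix.mul_assoc, ← Matrix.mul_assoc Q, hQproj, ← Matrix.mul_assoc, ← h]
  have h₂ : Vᴴ * Q * (V * P) = P := by
    rw [← Matrix.mul_assoc, ← h, hP]
  have h₃ : P * Vᴴ * (Q * V) = P := by
    rw [Matrix.mul_assoc, ← Matrix.mul_assoc Vᴴ, ← h, hP]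
  have h₄ : P * Vᴴ * (V * P) = P := by
    rw [Matrix.mul_assoc, ← Matrix.mul_assoc Vᴴ, hV, Matrix.one_mul, hP]
  rw [← sub_eq_zero, ← conjTranspose_mul_self_eq_zero, conjTranspose_sub, conjTranspose_mul,
    conjTranspose_mul, hQherm, hPherm, Matrix.sub_mul, Matrix.mul_sub, Matrix.mul_sub,
    h₁, h₂, h₃, h₄, sub_self]

/-- If `P` and `B` are projections, `V` is an isometry and `P = Vᴴ (B ⊗ 1) V`,
then `(B ⊗ 1) V = V P`. -/
theorem stmt_6 {d₁ d₂ dE : ℕ}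
    (V : Matrix (Fin d₂ × Fin dE) (Fin d₁) ℂ) (hV : Vᴴ * V = 1)
    (P : Matrix (Fin d₁) (Fin d₁) ℂ) (hPherm : Pᴴ = P) (hPproj : P * P = P)
    (B : Matrix (Fin d₂) (Fin d₂) ℂ) (hBherm : Bᴴ = B) (hBproj : B * B = B)
    (h : P = Vᴴ * (B ⊗ₖ (1 : Matrix (Fin dE) (Fin dE) ℂ)) * V) :
    (B ⊗ₖ (1 : Matrix (Fin dE) (Fin dE) ℂ)) * V = V * P := by
  refine mul_isometry_eq_isometry_mul_of_compression hV hPproj ?_ ?_ h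
  · rw [conjTranspose_kronecker, hBherm, conjTranspose_one]
  · rw [← mul_kronecker_mul, hBproj, Matrix.one_mul]
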